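/- There do not exist complex numbers k₁, k₂, k₃, m₁, t₂ satisfying simultaneously all of the following equations: k₃ = 1 − k₁k₂; k₂ + m₁k₃ − 1 = 0; (k₃ − 1) + t₂k₁ + k₁ = 0; −1 − (k₂ − 1)t₂k₁ + k₁ = 0; k₂ + m₁ − k₁k₂ + k₁ − 1 = 0; k₁k₂ + k₂k₃ − k₁ − k₂ = 0; k₁k₂ + k₁t₂ − t₂ − 1 = 0; and k₁k₂k₃ = 1. (This is the system of incidence equations arising from a hypothetical (4,4)-net in ℙ²(ℂ), whose unsolvability proves that no (4,4)-net exists.) -/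

import Mathlib

/-- The system of incidence equations arising from a hypothetical `(4,4)`-net in
`ℙ²(ℂ)` has no solution; this unsolvability proves that no `(4,4)`-net exists. -/
theorem no_solution_net_equations :
    ¬ ∃ k₁ k₂ k₃ m₁ t₂ : ℂ,
      k₃ = 1 - k₁ * k₂ ∧
      k₂ + m₁ * k₃ - 1 = 0 ∧
      (k₃ - 1) + t₂ * k₁ + k₁ = 0 ∧
      -1 - (k₂ - 1) * t₂ * k₁ + k₁ = 0 ∧
      k₂ + m₁ - k₁ * k₂ + k₁ - 1 = 0 ∧
      k₁ * k₂ + k₂ * k₃ - k₁ - k₂ = 0 ∧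
      k₁ * k₂ + k₁ * t₂ - t₂ - 1 = 0 ∧
      k₁ * k₂ * k₃ = 1 := by
  rintro ⟨k₁, k₂, k₃, m₁, t₂, rfl, -, h3, h4, -, h6, -, h8⟩
  have hk₁ : k₁ ≠ 0 := by
    rintro rfl
    simp at h8
  have ht : t₂ = k₂ - 1 := mul_left_cancel₀ hk₁ (by linear_combination h3)
  subst ht
  have hk₂ : k₂ ^ 2 - k₂ + 1 = 0 :=
    mul_left_cancel₀ hk₁ (by linear_combination -h6)
  have hsum : k₁ = 1 - k₁ * k₂ := by linear_combination h4 + k₁ * hk₂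
  have hsq : k₂ = (k₁ * k₂) ^ 2 := by
    linear_combination -k₂ * h8 - k₁ * k₂ ^ 2 * hsum
  generalize k₁ * k₂ = p at h8 hsq
  subst hsq
  have hp : p = 1 := by
    linear_combination (1 / 2 : ℂ) * (-hk₂ - (p ^ 2 + p - 1) * h8)
  subst hp
  norm_num at h8
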